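/- arXiv:math-ph/0208031 — 2 statements merged into one kernel-verified Lean document; each statement's English description precedes it below -/
import Mathlib

section
/- Let P be an infinite-dimensional Poisson algebra with identity over the field ℂ, and let 𝔤 ⊆ P be a ℂ-linear subspace closed under the bracket and satisfying {𝔤,𝔤} = 𝔤 (i.e., 𝔤 equals the span of the brackets of its elements). Suppose that the associative ideal of P generated by 𝔤 is all of P. Then every Lie ideal of P of finite codimension contains 𝔤. -/
/-- A Poisson bracket on a commutative unital `k`-algebra `P`: a `k`-bilinear map
which is antisymmetric, satisfies the Jacobi identity, and the Leibniz rule. -/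
structure PoissonBracket (k P : Type*) [CommRing k] [CommRing P] [Algebra k P] where
  bracket : P →ₗ[k] P →ₗ[k] P
  antisymm : ∀ a b : P, bracket a b = - bracket b a
  jacobi : ∀ a b c : P,
    bracket a (bracket b c) = bracket (bracket a b) c + bracket b (bracket a c)
  leibniz : ∀ a b c : P, bracket a (b * c) = bracket a b * c + b * bracket a c

open Polynomial in
theorem deriv_mem_maximal {P : Type*} [CommRing P] [Algebra ℂ P] (D : Derivation ℂ P P)
    (I : Ideal P) (hI : ∀ x ∈ I, D x ∈ I) {V : Type*} [AddCommGroup V] [Module ℂ V]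
    [FiniteDimensional ℂ V] (φ : P →ₗ[ℂ] V) (hφ : ∀ x, φ x = 0 → x ∈ I)
    (m : Ideal P) (hm : m.IsPrime) (hIm : I ≤ m) (a : P) : D a ∈ m := by
  obtain ⟨p, hp0, hp⟩ : ∃ p : ℂ[X], p ≠ 0 ∧ aeval a p ∈ I := by
    by_contra! hcon
    have hinj : Function.Injective (φ ∘ₗ (aeval a : ℂ[X] →ₐ[ℂ] P).toLinearMap) := by
      rw [← LinearMap.ker_eq_bot, LinearMap.ker_eq_bot']
      intro p hp
      by_contra h0
      exact hcon p h0 (hφ _ hp)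
    exact Polynomial.not_finite (R := ℂ) (Module.Finite.of_injective _ hinj)
  obtain ⟨l, hl⟩ : ∃ l : ℂ, a - algebraMap ℂ P l ∈ m := by
    by_contra! hcon
    have key : ∀ n : ℕ, ∀ p : ℂ[X], p.natDegree = n → p ≠ 0 → aeval a p ∉ m := by
      intro n
      induction n with
      | zero =>
        intro p hn h0 hmem
        rw [Polynomial.eq_C_of_natDegree_eq_zero hn] at hmem h0
        have hc : p.coeff 0 ≠ 0 := by simpa using h0
        rw [aeval_C] at hmem
        apply hm.ne_top
        exact Ideal.eq_top_of_isUnit_mem _ hmem ((IsUnit.mk0 _ hc).map _)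
      | succ n ih =>
        intro p hn h0 hmem
        obtain ⟨l, hl⟩ := IsAlgClosed.exists_root p (by
          intro h; rw [natDegree_eq_zero_iff_degree_le_zero.mpr h.le] at hn; omega)
        obtain ⟨q, rfl⟩ := dvd_iff_isRoot.mpr hl
        have hq : q ≠ 0 := right_ne_zero_of_mul h0
        rw [natDegree_mul (X_sub_C_ne_zero l) hq, natDegree_X_sub_C] at hn
        rw [map_mul] at hmem
        rcases hm.mem_or_mem hmem with h | h
        · exact hcon l (by simpa using h)
        · exact ih q (by omega) hq h
    exact key _ p rfl hp0 (hIm hp)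
  obtain ⟨q, hq, hnd⟩ := exists_eq_pow_rootMultiplicity_mul_and_not_dvd p hp0 l
  set k := p.rootMultiplicity l
  have hqm : aeval a q ∉ m := by
    intro hmem
    obtain ⟨r, hr⟩ := X_sub_C_dvd_sub_C_eval (a := l) (p := q)
    have h1 : aeval a q - algebraMap ℂ P (q.eval l) ∈ m := by
      have := congrArg (aeval a) hr
      simp only [map_sub, map_mul, aeval_C, aeval_X] at this
      rw [this]
      exact m.mul_mem_right _ hl
    have h2 : algebraMap ℂ P (q.eval l) ∈ m := by
      have := m.sub_mem hmem h1
      simpa using this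
    have hc : q.eval l ≠ 0 := fun h => hnd (dvd_iff_isRoot.mpr h)
    exact hm.ne_top (Ideal.eq_top_of_isUnit_mem _ h2 ((IsUnit.mk0 _ hc).map _))
  set b := a - algebraMap ℂ P l with hb
  have hDb : D b = D a := by simp [hb]
  have hbk : b ^ k * aeval a q ∈ I := by
    rw [hq] at hp
    simpa [hb] using hp
  rw [← hDb]
  set d := D b with hd
  have step : ∀ j n : ℕ, ∀ s : P, s ∉ m → s * (b ^ j * d ^ n) ∈ I → d ∈ m := by
    intro j
    induction j with
    | zero =>
      intro n s hs h
      rcases hm.mem_or_mem (hIm h) with h | h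
      · exact absurd h hs
      · rw [pow_zero, one_mul] at h
        exact hm.mem_of_pow_mem _ h
    | succ j ih =>
      intro n s hs h
      have h1 := hI _ h
      apply ih (n + 2) (s ^ 2) (fun h => hs (hm.mem_of_pow_mem _ h))
      have hn : d * D (d ^ n) = n * d ^ n * D d := by
        rw [Derivation.leibniz_pow]
        cases n with
        | zero => simp
        | succ n => simp [pow_succ]; ring
      have h2 : D (s * (b ^ (j+1) * d ^ n)) =
          s * (b ^ (j+1) * D (d ^ n) + d ^ n * ((j+1) * b ^ j * d)) +
            b ^ (j+1) * d ^ n * D s := by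
        rw [Derivation.leibniz, Derivation.leibniz, D.leibniz_pow (a := b)]
        simp [← hd]; ring
      rw [h2] at h1
      have h3 : ((j:P)+1) * (s ^ 2 * (b ^ j * d ^ (n+2))) ∈ I := by
        have e : ((j:P)+1) * (s ^ 2 * (b ^ j * d ^ (n+2))) =
          (s * d) * (s * (b ^ (j+1) * D (d ^ n) + d ^ n * ((j+1) * b ^ j * d)) +
            b ^ (j+1) * d ^ n * D s) - (d * D s + s * (n * D d)) * (s * (b ^ (j+1) * d ^ n)) := by
          linear_combination (- s ^ 2 * b ^ (j+1)) * hn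
        rw [e]
        exact I.sub_mem (I.mul_mem_left _ h1) (I.mul_mem_left _ h)
      have hu : algebraMap ℂ P ((j:ℂ)+1)⁻¹ * ((j:P)+1) = 1 := by
        have : ((j:P)+1) = algebraMap ℂ P ((j:ℂ)+1) := by simp
        rw [this, ← map_mul, inv_mul_cancel₀ (by exact_mod_cast Nat.succ_ne_zero j), map_one]
      have h4 := I.mul_mem_left (algebraMap ℂ P ((j:ℂ)+1)⁻¹) h3
      rwa [← mul_assoc, hu, one_mul] at h4
  exact step k 0 _ hqm (by simpa [mul_comm] using hbk)

/-- Let `P` be an infinite-dimensional Poisson algebra with identity over `ℂ`,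
and let `𝔤 ⊆ P` be a `ℂ`-linear subspace closed under the bracket with
`{𝔤,𝔤} = 𝔤`. If the associative ideal of `P` generated by `𝔤` is all of `P`,
then every Lie ideal of `P` of finite codimension contains `𝔤`. -/
theorem stmt_4 (P : Type*) [CommRing P] [Algebra ℂ P]
    (B : PoissonBracket ℂ P)
    (hinf : ¬ FiniteDimensional ℂ P)
    (𝔤 : Submodule ℂ P)
    (hclosed : ∀ x ∈ 𝔤, ∀ y ∈ 𝔤, B.bracket x y ∈ 𝔤)
    (hperfect : Submodule.span ℂ {z : P | ∃ x ∈ 𝔤, ∃ y ∈ 𝔤, B.bracket x y = z} = 𝔤)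
    (hideal : Ideal.span (𝔤 : Set P) = ⊤) :
    ∀ L : Submodule ℂ P,
      (∀ a : P, ∀ x ∈ L, B.bracket a x ∈ L) →
      FiniteDimensional ℂ (P ⧸ L) →
      𝔤 ≤ L := by
  intro L hL hfin
  have hL' : ∀ a : P, ∀ x ∈ L, B.bracket x a ∈ L := fun a x hx => by
    rw [B.antisymm]; exact L.neg_mem (hL a x hx)
  let N : Submodule ℂ P :=
    { carrier := {f | ∀ a, B.bracket f a ∈ L}
      add_mem' := fun hx hy a => by
        rw [map_add, LinearMap.add_apply]; exact L.add_mem (hx a) (hy a)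
      zero_mem' := fun a => by simp
      smul_mem' := fun c x hx a => by
        rw [map_smul, LinearMap.smul_apply]; exact L.smul_mem c (hx a) }
  have hLN : L ≤ N := fun x hx a => hL' a x hx
  have hNmul : ∀ x ∈ N, ∀ y ∈ N, x * y ∈ N := by
    intro x hx y hy a
    have e : B.bracket (x * y) a = B.bracket x (y * a) + B.bracket y (x * a) := by
      rw [B.antisymm (x * y) a, B.leibniz, B.leibniz, B.leibniz, B.antisymm a x,
        B.antisymm a y, B.antisymm y x]
      ring
    rw [e]
    exact L.add_mem (hx _) (hy _)
  have hNlie : ∀ a : P, ∀ x ∈ N, B.bracket a x ∈ N := by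
    intro a x hx
    apply hLN
    rw [B.antisymm]; exact L.neg_mem (hx a)
  let I : Ideal P :=
    { carrier := {f | ∀ a, f * a ∈ N}
      add_mem' := fun hx hy a => by
        rw [add_mul]; exact N.add_mem (hx a) (hy a)
      zero_mem' := fun a => by simp
      smul_mem' := fun c x hx a => by
        have := hx (c * a)
        rw [smul_eq_mul, mul_comm c x, mul_assoc]; exact this }
  have hIlie : ∀ a : P, ∀ x ∈ I, B.bracket a x ∈ I := by
    intro a x hx b
    have e : B.bracket a x * b = B.bracket a (x * b) - x * B.bracket a b := by
      rw [B.leibniz]; ring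
    rw [e]
    exact N.sub_mem (hNlie _ _ (hx b)) (hx _)
  have hfinN : FiniteDimensional ℂ (P ⧸ N) :=
    Module.Finite.of_surjective (Submodule.factor hLN) (Submodule.factor_surjective hLN)
  obtain ⟨W, hW⟩ := N.exists_isCompl
  have hfinW : FiniteDimensional ℂ W :=
    Module.Finite.equiv (Submodule.quotientEquivOfIsCompl N W hW)
  let φ : P →ₗ[ℂ] (P ⧸ N) × (W →ₗ[ℂ] (P ⧸ N)) :=
    N.mkQ.prod ((LinearMap.mul ℂ P).compr₂ N.mkQ |>.compl₂ W.subtype)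
  have hφ : ∀ x, φ x = 0 → x ∈ I := by
    intro x hx a
    have h1 : x ∈ N := by
      have := congrArg Prod.fst hx
      simpa [φ] using this
    have h2 : ∀ w ∈ W, x * w ∈ N := by
      intro w hw
      have := LinearMap.congr_fun (congrArg Prod.snd hx) ⟨w, hw⟩
      simpa [φ] using this
    have ha : a ∈ N ⊔ W := by rw [hW.sup_eq_top]; trivial
    obtain ⟨n, hn, w, hw, rfl⟩ := Submodule.mem_sup.mp ha
    rw [mul_add]
    exact N.add_mem (hNmul _ h1 _ hn) (h2 w hw)
  have hItop : I = ⊤ := by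
    by_contra hne
    obtain ⟨m, hm, hIm⟩ := I.exists_le_maximal hne
    have hbr : ∀ a b : P, B.bracket a b ∈ m := by
      intro a b
      let D : Derivation ℂ P P := Derivation.mk' (B.bracket a) (fun x y => by
        rw [B.leibniz, smul_eq_mul, smul_eq_mul]; ring)
      exact deriv_mem_maximal D I (fun x hx => hIlie a x hx) φ hφ m hm.isPrime hIm b
    have hgm : 𝔤 ≤ m.restrictScalars ℂ := by
      rw [← hperfect, Submodule.span_le]
      rintro z ⟨x, -, y, -, rfl⟩
      exact hbr x y
    apply hm.ne_top
    rw [eq_top_iff, ← hideal, Ideal.span_le]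
    exact fun x hx => hgm hx
  rw [← hperfect, Submodule.span_le]
  rintro z ⟨x, -, y, -, rfl⟩
  have hx : x ∈ I := by rw [hItop]; trivial
  have := hx 1
  rw [mul_one] at this
  exact this y
end

section
/- Let P be an infinite-dimensional Poisson algebra with identity over the field ℂ, and let 𝔤 ⊆ P be a ℂ-linear subspace closed under the bracket and satisfying {𝔤,𝔤} = 𝔤. Suppose that the associative ideal of P generated by 𝔤 is all of P. Then for every finite-dimensional ℂ-vector space V and every ℂ-linear map γ: P → End(V) satisfying γ({a,b}) = γ(a)γ(b) − γ(b)γ(a) for all a, b ∈ P (i.e., γ is a Lie algebra representation of P with respect to the Poisson bracket), one has γ(x) = 0 for all x ∈ 𝔤. -/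
/-- In an Artinian quotient `P/J`, a `J`-preserving derivation maps a maximal `M ⊇ J` to itself. -/
theorem aux_deriv (P : Type*) [CommRing P] [Algebra ℂ P] (D : P →ₗ[ℂ] P)
    (hD : ∀ b c, D (b * c) = D b * c + b * D c) (J M : Ideal P) [hM : M.IsMaximal]
    (hJM : J ≤ M) (hJ : ∀ x ∈ J, D x ∈ J) [IsArtinianRing (P ⧸ J)]
    (c : P) (hc : c ∈ M) : D c ∈ M := by
  classical
  have hex : ∃ m : ℕ, ∃ s : P, s ∉ M ∧ c ^ m * s ∈ J := by
    obtain ⟨n, y, hy⟩ := IsArtinian.exists_pow_succ_smul_dvd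
      (R := P ⧸ J) (M := P ⧸ J) (Ideal.Quotient.mk J c) 1
    obtain ⟨r, rfl⟩ := Ideal.Quotient.mk_surjective y
    refine ⟨n, c * r - 1, ?_, ?_⟩
    · intro h
      apply hM.ne_top
      rw [Ideal.eq_top_iff_one]
      have := M.sub_mem (M.mul_mem_right r hc) h
      simpa using this
    · rw [← Ideal.Quotient.eq_zero_iff_mem]
      simp only [smul_eq_mul, mul_one] at hy
      simp only [map_mul, map_pow, map_sub, map_one]
      rw [← sub_eq_zero] at hy
      rw [← hy, Nat.succ_eq_add_one]; ring
  by_contra hDc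
  obtain ⟨s, hs, hsJ⟩ := Nat.find_spec hex
  have hmin := fun k => Nat.find_min hex (m := k)
  generalize Nat.find hex = m at *
  have hpow : ∀ k : ℕ, D (c ^ (k+1)) = (k+1 : ℂ) • (c ^ k * D c) := by
    intro k
    induction k with
    | zero => simp
    | succ k ih =>
      rw [pow_succ, hD, ih]
      simp only [Algebra.smul_def, map_add, map_one, map_natCast, Nat.cast_add, Nat.cast_one]
      ring
  cases m with
  | zero => exact hs (hJM (by simpa using hsJ))
  | succ k =>
    apply hmin k (Nat.lt_succ_self k)
    refine ⟨D c * (s * s), ?_, ?_⟩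
    · intro h
      rcases hM.isPrime.mem_or_mem h with h | h
      · exact hDc h
      · rcases hM.isPrime.mem_or_mem h with h | h <;> exact hs h
    · have h1 := J.mul_mem_left s (hJ _ hsJ)
      rw [hD, hpow] at h1
      have h2 := J.sub_mem h1 (J.mul_mem_left (D s) hsJ)
      have h3 := J.mul_mem_left (algebraMap ℂ P ((k+1 : ℂ)⁻¹)) h2
      have hk : (k + 1 : ℂ) ≠ 0 := by exact_mod_cast Nat.succ_ne_zero k
      have hu : algebraMap ℂ P ((k+1 : ℂ)⁻¹) * algebraMap ℂ P (k+1 : ℂ) = 1 := by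
        rw [← map_mul, inv_mul_cancel₀ hk, map_one]
      convert h3 using 1
      rw [Algebra.smul_def]
      linear_combination (-(c ^ k * (D c * (s * s)))) * hu

theorem stmt_5 (P : Type*) [CommRing P] [Algebra ℂ P]
    (B : PoissonBracket ℂ P)
    (hinf : ¬ FiniteDimensional ℂ P)
    (𝔤 : Submodule ℂ P)
    (hclosed : ∀ x ∈ 𝔤, ∀ y ∈ 𝔤, B.bracket x y ∈ 𝔤)
    (hperfect : Submodule.span ℂ {z : P | ∃ x ∈ 𝔤, ∃ y ∈ 𝔤, B.bracket x y = z} = 𝔤)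
    (hideal : Ideal.span (𝔤 : Set P) = ⊤) :
    ∀ (V : Type*) [AddCommGroup V] [Module ℂ V] [FiniteDimensional ℂ V]
      (γ : P →ₗ[ℂ] Module.End ℂ V),
      (∀ a b : P, γ (B.bracket a b) = γ a * γ b - γ b * γ a) →
      ∀ x ∈ 𝔤, γ x = 0 := by
  intro V _ _ _ γ hγ
  have hL : ∀ a b, γ b = 0 → γ (B.bracket a b) = 0 := by
    intro a b h; rw [hγ, h]; simp
  have hr : ∀ a b c, B.bracket (a * b) c = a * B.bracket b c + b * B.bracket a c := by
    intro a b c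
    rw [B.antisymm, B.leibniz, B.antisymm c a, B.antisymm c b]; ring
  -- U = {f | {f, P} ⊆ ker γ}
  let U : Submodule ℂ P :=
    { carrier := {f | ∀ p, γ (B.bracket f p) = 0}
      add_mem' := by
        intro a b ha hb p
        have h1 := ha p
        have h2 := hb p
        simp [h1, h2]
      zero_mem' := by intro p; simp
      smul_mem' := by
        intro c a ha p
        have h1 := ha p
        simp [h1] }
  have hU : ∀ f, f ∈ U ↔ ∀ p, γ (B.bracket f p) = 0 := fun f => Iff.rfl
  have hUmul : ∀ a ∈ U, ∀ b ∈ U, a * b ∈ U := by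
    intro a ha b hb c
    have e : B.bracket (a * b) c = B.bracket a (b * c) + B.bracket b (c * a) := by
      rw [hr, B.leibniz, B.leibniz, B.antisymm b a]; ring
    rw [e, map_add, ha, hb, add_zero]
  have hULie : ∀ g, ∀ f ∈ U, B.bracket g f ∈ U := by
    intro g f hf p
    have e := B.jacobi g f p
    have e2 : B.bracket (B.bracket g f) p
        = B.bracket g (B.bracket f p) - B.bracket f (B.bracket g p) := by rw [e]; ring
    rw [e2, map_sub, hL _ _ (hf p), hf, sub_zero]
  have hLU : LinearMap.ker γ ≤ U := by
    intro f hf p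
    rw [B.antisymm, map_neg, hL _ _ (by simpa using hf), neg_zero]
  haveI : FiniteDimensional ℂ (P ⧸ LinearMap.ker γ) :=
    Module.Finite.equiv γ.quotKerEquivRange.symm
  haveI : FiniteDimensional ℂ (P ⧸ U) :=
    Module.Finite.of_surjective (Submodule.factor hLU) (Submodule.factor_surjective hLU)
  obtain ⟨W, hW⟩ := U.exists_isCompl
  haveI : FiniteDimensional ℂ W :=
    Module.Finite.equiv (Submodule.quotientEquivOfIsCompl U W hW)
  let J : Ideal P :=
    { carrier := {f | ∀ p, f * p ∈ U}
      add_mem' := by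
        intro a b ha hb p
        rw [add_mul]; exact U.add_mem (ha p) (hb p)
      zero_mem' := by intro p; simp
      smul_mem' := by
        intro c a ha p
        have : c • a * p = a * (c * p) := by rw [smul_eq_mul]; ring
        rw [this]; exact ha _ }
  have hJmem : ∀ f, f ∈ J ↔ ∀ p, f * p ∈ U := fun f => Iff.rfl
  have hJU : ∀ f ∈ J, f ∈ U := fun f hf => by simpa using hf 1
  let Φ : P →ₗ[ℂ] (P ⧸ U) × (W →ₗ[ℂ] (P ⧸ U)) :=
    U.mkQ.prod ((LinearMap.mul ℂ P).compr₂ U.mkQ |>.compl₂ W.subtype)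
  have hΦ : LinearMap.ker Φ ≤ J.restrictScalars ℂ := by
    intro f hf
    rw [LinearMap.mem_ker, Prod.ext_iff] at hf
    obtain ⟨h1, h2⟩ := hf
    have h1' : f ∈ U := by simpa [Φ] using h1
    have h2' : ∀ w ∈ W, f * w ∈ U := by
      intro w hw
      have := LinearMap.congr_fun h2 ⟨w, hw⟩
      simpa [Φ] using this
    change ∀ p, f * p ∈ U
    intro p
    have hp : p ∈ U ⊔ W := by rw [hW.sup_eq_top]; trivial
    obtain ⟨u, hu, w, hw, rfl⟩ := Submodule.mem_sup.1 hp
    rw [mul_add]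
    exact U.add_mem (hUmul _ h1' _ hu) (h2' _ hw)
  haveI : FiniteDimensional ℂ (P ⧸ LinearMap.ker Φ) :=
    Module.Finite.equiv Φ.quotKerEquivRange.symm
  haveI : FiniteDimensional ℂ (P ⧸ J.restrictScalars ℂ) :=
    Module.Finite.of_surjective (Submodule.factor hΦ) (Submodule.factor_surjective hΦ)
  haveI hfin : FiniteDimensional ℂ (P ⧸ J) :=
    Module.Finite.equiv (Submodule.Quotient.restrictScalarsEquiv ℂ J)
  haveI : IsArtinianRing (P ⧸ J) := IsArtinianRing.of_finite ℂ (P ⧸ J)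
  have hJD : ∀ a, ∀ x ∈ J, B.bracket a x ∈ J := by
    intro a x hx q
    have e : B.bracket a x * q = B.bracket a (x * q) - x * B.bracket a q := by
      rw [B.leibniz]; ring
    rw [e]
    exact U.sub_mem (hULie _ _ (hx q)) (hx _)
  have hJtop : J = ⊤ := by
    by_contra hne
    obtain ⟨M, hM, hJM⟩ := Ideal.exists_le_maximal J hne
    haveI : FiniteDimensional ℂ (P ⧸ M) :=
      Module.Finite.of_surjective (Ideal.Quotient.factorₐ ℂ hJM).toLinearMap
        (Ideal.Quotient.factor_surjective hJM)
    haveI : Algebra.IsIntegral ℂ (P ⧸ M) := inferInstance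
    have hbij := IsAlgClosed.algebraMap_bijective_of_isIntegral (k := ℂ) (K := P ⧸ M)
    have hDM : ∀ a b, B.bracket a b ∈ M := by
      intro a b
      obtain ⟨β, hβ⟩ := hbij.2 (Ideal.Quotient.mk M b)
      have hc : b - algebraMap ℂ P β ∈ M := by
        rw [← Ideal.Quotient.eq_zero_iff_mem, map_sub, ← hβ]
        exact sub_self _
      have h := aux_deriv P (B.bracket a) (B.leibniz a) J M hJM (hJD a) _ hc
      have h1 : B.bracket a 1 = 0 := by simpa using B.leibniz a 1 1
      rw [map_sub, Algebra.algebraMap_eq_smul_one, map_smul, h1] at h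
      simpa using h
    apply hM.ne_top
    rw [eq_top_iff, ← hideal, Ideal.span_le]
    have : 𝔤 ≤ M.restrictScalars ℂ := by
      rw [← hperfect, Submodule.span_le]
      rintro z ⟨x, _, y, _, rfl⟩
      exact hDM x y
    exact this
  have : 𝔤 ≤ LinearMap.ker γ := by
    rw [← hperfect, Submodule.span_le]
    rintro z ⟨x, _, y, _, rfl⟩
    have hx : x ∈ J := by rw [hJtop]; trivial
    exact hJU x hx y
  exact fun x hx => this hx
end
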